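/- Under the hypotheses of the truncated t-SVD optimality theorem (M = U*S*V^⊤ a t-SVD whose Fourier-domain diagonal entries Ŝ(i,i,ω) are the nonincreasing singular values of M̂(:,:,ω) for each ω), the truncation error satisfies ‖M − M_k‖_F² = (1/n₃) Σ_{ω∈ℤ/n₃ℤ} Σ_{i>k} σ_i(M̂(:,:,ω))², where σ_i(·) denotes the i-th largest singular value and M_k = Σ_{i=1}^{k} U(:,i,:) * S(i,i,:) * V(:,i,:)^⊤. -/

import Mathlib

open scoped BigOperators

noncomputable section

/-- A third-order real tensor of size `n₁ × n₂ × n₃`, with cyclic third index. -/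
abbrev T3 (n1 n2 n3 : ℕ) := Fin n1 → Fin n2 → ZMod n3 → ℝ

/-- The t-product of two third-order tensors:
`C(i,j,:) = ∑ₖ A(i,k,:) ⊛ B(k,j,:)` where `⊛` is circular convolution. -/
def tProd {n1 n2 n4 n3 : ℕ} [NeZero n3] (A : T3 n1 n2 n3) (B : T3 n2 n4 n3) :
    T3 n1 n4 n3 :=
  fun i j t => ∑ k : Fin n2, ∑ s : ZMod n3, A i k s * B k j (t - s)

/-- Unnormalized DFT along the third dimension:
`Â(i,j,ω) = ∑ₜ A(i,j,t) e^{-2πiωt/n₃}`. -/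
def dft {n1 n2 n3 : ℕ} [NeZero n3] (A : T3 n1 n2 n3) :
    Fin n1 → Fin n2 → ZMod n3 → ℂ :=
  fun i j ω => ∑ t : ZMod n3, (A i j t : ℂ) *
    Complex.exp (-2 * Real.pi * Complex.I * ((ω.val : ℂ) * (t.val : ℂ)) / (n3 : ℂ))

/-- Tensor transpose: `Aᵀ(i,j,t) = A(j,i,-t)`, i.e. transpose each frontal slice
and reverse the order of frontal slices `2 … n₃`. -/
def tT {n1 n2 n3 : ℕ} (A : T3 n1 n2 n3) : T3 n2 n1 n3 :=
  fun i j t => A j i (-t)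

/-- The identity tensor: first frontal slice is the identity matrix, others zero. -/
def idT (n n3 : ℕ) : T3 n n n3 :=
  fun i j t => if i = j ∧ t = 0 then 1 else 0

/-- An orthogonal tensor: `Qᵀ*Q = Q*Qᵀ = I`. -/
def IsOrthogonalT {n n3 : ℕ} [NeZero n3] (Q : T3 n n n3) : Prop :=
  tProd (tT Q) Q = idT n n3 ∧ tProd Q (tT Q) = idT n n3

/-- Squared Frobenius norm of a third-order tensor. -/
def frobSq {n1 n2 n3 : ℕ} [NeZero n3] (A : T3 n1 n2 n3) : ℝ :=
  ∑ i : Fin n1, ∑ j : Fin n2, ∑ t : ZMod n3, (A i j t) ^ 2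

/-- f-diagonal tensor: every frontal slice is a diagonal matrix. -/
def IsFDiagonal {n1 n2 n3 : ℕ} (S : T3 n1 n2 n3) : Prop :=
  ∀ (i : Fin n1) (j : Fin n2), (i : ℕ) ≠ (j : ℕ) → ∀ t : ZMod n3, S i j t = 0

/-- The truncated t-SVD `M_k = ∑_{i=1}^{k} U(:,i,:) * S(i,i,:) * V(:,i,:)ᵀ`,
a sum of t-products of lateral slices (n₁×1×n₃), tubes (1×1×n₃) and
transposed lateral slices (1×n₂×n₃). -/
def truncT {n1 n2 n3 : ℕ} [NeZero n3] (U : T3 n1 n1 n3) (S : T3 n1 n2 n3)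
    (V : T3 n2 n2 n3) (k : ℕ) (hk1 : k ≤ n1) (hk2 : k ≤ n2) : T3 n1 n2 n3 :=
  ∑ i : Fin k,
    tProd
      (tProd (fun a (_ : Fin 1) t => U a (Fin.castLE hk1 i) t)
             (fun (_ : Fin 1) (_ : Fin 1) t => S (Fin.castLE hk1 i) (Fin.castLE hk2 i) t))
      (tT (fun b (_ : Fin 1) t => V b (Fin.castLE hk2 i) t))

theorem tT_tT {n1 n2 n3 : ℕ} (A : T3 n1 n2 n3) : tT (tT A) = A := by
  funext i j t
  simp [tT]

section Algebra

variable {n1 n2 n4 n5 n3 : ℕ} [NeZero n3]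

theorem tProd_assoc (A : T3 n1 n2 n3) (B : T3 n2 n4 n3) (C : T3 n4 n5 n3) :
    tProd (tProd A B) C = tProd A (tProd B C) := by
  funext i j t
  simp only [tProd, Finset.sum_mul, Finset.mul_sum]
  calc
    _ = ∑ k, ∑ l, ∑ s, ∑ r, A i l r * B l k (s - r) * C k j (t - s) :=
      Finset.sum_congr rfl fun k _ => Finset.sum_comm
    _ = ∑ l, ∑ k, ∑ r, ∑ s, A i l r * B l k (s - r) * C k j (t - s) := by
      rw [Finset.sum_comm]
      exact Finset.sum_congr rfl fun l _ => Finset.sum_congr rfl fun k _ => Finset.sum_comm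
    _ = ∑ l, ∑ k, ∑ r, ∑ s, A i l r * (B l k s * C k j (t - r - s)) := by
      refine Finset.sum_congr rfl fun l _ => Finset.sum_congr rfl fun k _ =>
        Finset.sum_congr rfl fun r _ => ?_
      refine Fintype.sum_equiv (Equiv.subRight r) _ _ fun s => ?_
      simp [mul_assoc]
    _ = _ := Finset.sum_congr rfl fun l _ => Finset.sum_comm

theorem tT_tProd (A : T3 n1 n2 n3) (B : T3 n2 n4 n3) :
    tT (tProd A B) = tProd (tT B) (tT A) := by
  funext i j t
  simp only [tT, tProd]
  refine Finset.sum_congr rfl fun k _ => ?_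
  refine Fintype.sum_equiv (Equiv.addLeft t) _ _ fun s => ?_
  simp only [Equiv.coe_addLeft]
  rw [mul_comm]
  congr 2 <;> ring

theorem idT_tProd (A : T3 n1 n2 n3) : tProd (idT n1 n3) A = A := by
  funext i j t
  simp [tProd, idT, ite_and]

theorem tProd_sub (A : T3 n1 n2 n3) (B C : T3 n2 n4 n3) :
    tProd A (B - C) = tProd A B - tProd A C := by
  funext i j t
  simp [tProd, mul_sub]

theorem sub_tProd (A B : T3 n1 n2 n3) (C : T3 n2 n4 n3) :
    tProd (A - B) C = tProd A C - tProd B C := by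
  funext i j t
  simp [tProd, sub_mul]

theorem frobSq_eq_trace (A : T3 n1 n2 n3) :
    frobSq A = ∑ j, tProd (tT A) A j j 0 := by
  simp only [frobSq, tProd, tT, zero_sub]
  rw [Finset.sum_comm]
  refine Finset.sum_congr rfl fun j _ => Finset.sum_congr rfl fun i _ => ?_
  refine Fintype.sum_equiv (Equiv.neg _) _ _ fun t => ?_
  simp [sq]

theorem frobSq_tT (A : T3 n1 n2 n3) : frobSq (tT A) = frobSq A := by
  simp only [frobSq, tT]
  rw [Finset.sum_comm]
  refine Finset.sum_congr rfl fun j _ => Finset.sum_congr rfl fun i _ => ?_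
  exact Fintype.sum_equiv (Equiv.neg _) _ _ fun t => rfl

theorem frobSq_orthogonal_tProd {Q : T3 n1 n1 n3} (hQ : IsOrthogonalT Q) (A : T3 n1 n2 n3) :
    frobSq (tProd Q A) = frobSq A := by
  rw [frobSq_eq_trace, frobSq_eq_trace, tT_tProd, tProd_assoc, ← tProd_assoc (tT Q), hQ.1,
    idT_tProd]

theorem frobSq_tProd_orthogonal {Q : T3 n2 n2 n3} (hQ : IsOrthogonalT Q) (A : T3 n1 n2 n3) :
    frobSq (tProd A (tT Q)) = frobSq A := by
  rw [← frobSq_tT, tT_tProd, tT_tT, frobSq_orthogonal_tProd hQ, frobSq_tT]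

theorem truncT_eq (U : T3 n1 n1 n3) {S : T3 n1 n2 n3} (V : T3 n2 n2 n3) (hS : IsFDiagonal S)
    (k : ℕ) (hk1 : k ≤ n1) (hk2 : k ≤ n2) :
    truncT U S V k hk1 hk2 =
      tProd (tProd U fun i j t => if (i : ℕ) < k then S i j t else 0) (tT V) := by
  funext a b t
  simp only [truncT, Finset.sum_apply, tProd, tT, Finset.univ_unique, Finset.sum_singleton]
  simp_rw [Finset.sum_mul]
  refine Eq.trans ?_ (Finset.sum_congr rfl fun j _ => Finset.sum_comm)
  refine Eq.trans ?_ (Finset.sum_product' _ _ _)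
  refine Finset.sum_of_injOn (fun i => (Fin.castLE hk2 i, Fin.castLE hk1 i)) ?_ ?_ ?_ ?_
  · intro i _ j _ h
    simpa using h
  · intro i _
    simp
  · rintro ⟨j, i⟩ - hij
    refine Finset.sum_eq_zero fun s _ => Finset.sum_eq_zero fun r _ => ?_
    by_cases hi : (i : ℕ) < k
    · have h : (i : ℕ) ≠ j := fun h => hij ⟨⟨i, hi⟩, by simp, by ext <;> simp [h]⟩
      simp [hS i j h]
    · simp [hi]
  · intro i _
    simp

end Algebra

theorem dft_eq_sum_stdAddChar {n1 n2 n3 : ℕ} [NeZero n3] (A : T3 n1 n2 n3) (i : Fin n1)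
    (j : Fin n2) (ω : ZMod n3) :
    dft A i j ω = ∑ t, (A i j t : ℂ) * ZMod.stdAddChar (-(ω * t)) := by
  refine Finset.sum_congr rfl fun t _ => ?_
  have h : -(ω * t) = ((-(ω.val * t.val : ℤ) : ℤ) : ZMod n3) := by simp
  rw [h, ZMod.stdAddChar_coe]
  congr 2
  push_cast
  ring

theorem sum_normSq_dft {n1 n2 n3 : ℕ} [NeZero n3] (A : T3 n1 n2 n3) (i : Fin n1) (j : Fin n2) :
    ∑ ω, Complex.normSq (dft A i j ω) = n3 * ∑ t, A i j t ^ 2 := by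
  apply Complex.ofReal_injective
  push_cast
  simp only [Complex.normSq_eq_conj_mul_self, dft_eq_sum_stdAddChar, map_sum, map_mul,
    Complex.conj_ofReal, ← AddChar.map_neg_eq_conj, neg_neg, Finset.sum_mul_sum]
  calc
    _ = ∑ t, ∑ s, (A i j t : ℂ) * A i j s *
        ∑ ω : ZMod n3, ZMod.stdAddChar (ω * (t - s)) := by
      rw [Finset.sum_comm]
      refine Finset.sum_congr rfl fun t _ => ?_
      rw [Finset.sum_comm]
      refine Finset.sum_congr rfl fun s _ => ?_
      rw [Finset.mul_sum]
      refine Finset.sum_congr rfl fun ω _ => ?_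
      rw [mul_sub, sub_eq_add_neg, AddChar.map_add_eq_mul]
      ring
    _ = _ := by
      simp only [AddChar.sum_mulShift _ (ZMod.isPrimitive_stdAddChar n3), sub_eq_zero, ZMod.card]
      simp [Finset.mul_sum]
      exact Finset.sum_congr rfl fun t _ => by ring

/-- under the hypotheses of the truncated t-SVD optimality theorem
(the Fourier-domain diagonal entries `Ŝ(i,i,ω)` are the nonincreasing singular
values of `M̂(:,:,ω)` for each ω), the truncation error satisfies
`‖M − M_k‖_F² = (1/n₃) ∑_ω ∑_{i>k} σ_i(M̂(:,:,ω))²`, where `σ_i(M̂(:,:,ω)) = Ŝ(i,i,ω)`. -/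
theorem truncated_tSVD_error {n1 n2 n3 : ℕ} [NeZero n3]
    (M : T3 n1 n2 n3) (U : T3 n1 n1 n3) (S : T3 n1 n2 n3) (V : T3 n2 n2 n3)
    (hU : IsOrthogonalT U) (hV : IsOrthogonalT V) (hS : IsFDiagonal S)
    (hM : M = tProd (tProd U S) (tT V))
    (hdiag : ∀ (ω : ZMod n3) (i : Fin n1) (j : Fin n2), (i : ℕ) = (j : ℕ) →
      (dft S i j ω).im = 0 ∧ 0 ≤ (dft S i j ω).re)
    (hmono : ∀ (ω : ZMod n3) (i i' : Fin n1) (j j' : Fin n2),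
      (i : ℕ) = (j : ℕ) → (i' : ℕ) = (j' : ℕ) → (i : ℕ) ≤ (i' : ℕ) →
      (dft S i' j' ω).re ≤ (dft S i j ω).re)
    (k : ℕ) (hk : k < min n1 n2) :
    frobSq (M - truncT U S V k (by omega) (by omega)) =
      (1 / (n3 : ℝ)) * ∑ ω : ZMod n3, ∑ i : Fin n1, ∑ j : Fin n2,
        if (i : ℕ) = (j : ℕ) ∧ k ≤ (i : ℕ) then (dft S i j ω).re ^ 2 else 0 := by
  have hn : (n3 : ℝ) ≠ 0 := Nat.cast_ne_zero.2 (NeZero.ne n3)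
  rw [hM, truncT_eq U V hS, ← sub_tProd, ← tProd_sub, frobSq_tProd_orthogonal hV,
    frobSq_orthogonal_tProd hU, Finset.sum_comm (s := (Finset.univ : Finset (ZMod n3))),
    Finset.mul_sum]
  refine Finset.sum_congr rfl fun i _ => ?_
  rw [Finset.sum_comm (s := (Finset.univ : Finset (ZMod n3))), Finset.mul_sum]
  refine Finset.sum_congr rfl fun j _ => ?_
  by_cases hij : (i : ℕ) = j
  · by_cases hik : k ≤ (i : ℕ)
    · have hsq : ∀ ω, (dft S i j ω).re ^ 2 = Complex.normSq (dft S i j ω) := fun ω => by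
        rw [Complex.normSq_apply, (hdiag ω i j hij).1]
        ring
      simp only [hij, hij ▸ hik, hsq, true_and, if_true, sum_normSq_dft]
      field_simp
      simp [hik.not_gt]
    · have hjk : (j : ℕ) < k := by omega
      simp [hij, hjk]
  · simp [hij, hS i j hij]
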